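/- arXiv:1803.09446 — 2 statements merged into one kernel-verified Lean document; each statement's English description precedes it below -/
import Mathlib

section
/- Suppose F satisfies Assumption 4.1 (i)–(iii), and fix T > 0, θ ∈ (0,1/5) and C₂ > 0. Let O ⊂ ℝ^d be open and bounded. Then there exist δ₁ ∈ (0,∞), ϵ ∈ (0,∞), κ ∈ (0,1/6) and C > 0 such that for every (t,x,z) ∈ [0,T]×O×ℝ, every δ ∈ (0,δ₁], and every C³ function φ on ℝ^d with Σ_{|α|₁≤3} sup_y |D^α φ(y)| ≤ C₂ δ^{−θ}, one has | φ(x) − δ F(t,x,z,Dφ(x),D²φ(x)) − sup_{(p,X)∈D_δ} inf_{w∈X_{δ,κ}} [ φ(x + √δ w) − √δ wᵀp − (δ/2) wᵀX w − δ F(t,x,z,p,X) ] | ≤ C δ^{1+ϵ}, where D_δ = {(p,X) ∈ ℝ^d × S^d : |p| ≤ C₂δ^{−θ}, |X| ≤ C₂δ^{−θ}} and X_{δ,κ} = {w ∈ ℝ^d : |w| ≤ δ^{−κ}}. -/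
open MeasureTheory Filter Topology Set

noncomputable section

/-- Euclidean space `ℝ^d`. -/
abbrev Euc (d : ℕ) := EuclideanSpace ℝ (Fin d)

/-- Frobenius norm of a `d × d` real matrix. -/
def frobNorm {d : ℕ} (X : Matrix (Fin d) (Fin d) ℝ) : ℝ :=
  Real.sqrt (∑ i, ∑ j, (X i j) ^ 2)

/-- Hessian matrix of `φ : ℝ^d → ℝ` at `x`. -/
def hessian {d : ℕ} (φ : Euc d → ℝ) (x : Euc d) : Matrix (Fin d) (Fin d) ℝ :=
  Matrix.of fun i j =>
    fderiv ℝ (fun y => fderiv ℝ φ y (EuclideanSpace.single j 1)) x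
      (EuclideanSpace.single i 1)

/-- The partial derivative in the `i`-th coordinate direction. -/
def pderiv' {d : ℕ} (i : Fin d) (φ : Euc d → ℝ) : Euc d → ℝ :=
  fun y => fderiv ℝ φ y (EuclideanSpace.single i 1)

/-- The multi-index partial derivative `D^α`. -/
def Dmulti {d : ℕ} (α : Fin d → ℕ) (φ : Euc d → ℝ) : Euc d → ℝ :=
  ((List.ofFn (fun i : Fin d => (fun ψ : Euc d → ℝ => pderiv' i ψ)^[α i])).foldr
    (· ∘ ·) id) φ

/-- The finite set of multi-indices `α` with `|α|₁ ≤ 3`. -/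
def multiIdx3 (d : ℕ) : Finset (Fin d → ℕ) :=
  (Fintype.piFinset fun _ : Fin d => Finset.range 4).filter fun α => (∑ i, α i) ≤ 3

/-- Assumption 4.1 (i)–(iii) on the nonlinearity `F`. -/
def Assumption41F {d : ℕ} (T C₀ : ℝ)
    (F : ℝ → Euc d → ℝ → Euc d → Matrix (Fin d) (Fin d) ℝ → ℝ) : Prop :=
  (∀ t ∈ Icc (0:ℝ) T, ∀ (x : Euc d) (z : ℝ) (p : Euc d),
      ∀ X X' : Matrix (Fin d) (Fin d) ℝ, X.IsSymm → X'.IsSymm →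
      (X - X').PosSemidef → F t x z p X ≤ F t x z p X') ∧
  (∃ F₀ : ℝ → ℝ, ContinuousOn F₀ (Icc 0 T) ∧
      ∀ t ∈ Icc (0:ℝ) T, ∀ t' ∈ Icc (0:ℝ) T,
      ∀ (x x' : Euc d) (z z' : ℝ) (p p' : Euc d),
      ∀ X X' : Matrix (Fin d) (Fin d) ℝ, X.IsSymm → X'.IsSymm →
      |F t x z p X - F t' x' z' p' X'| ≤
        |F₀ t - F₀ t'| + C₀ * (‖x - x'‖ + |z - z'| + ‖p - p'‖ + frobNorm (X - X'))) ∧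
  (∀ t ∈ Icc (0:ℝ) T, ∀ (x : Euc d) (z : ℝ) (p : Euc d),
      ∀ X : Matrix (Fin d) (Fin d) ℝ, X.IsSymm →
      |F t x z p X| ≤ C₀ * (1 + |z| + ‖p‖ + frobNorm X))

section

variable {d : ℕ}

/-- The iterated partial derivative along a list of coordinate directions, head outermost. -/
def pderivList (l : List (Fin d)) (φ : Euc d → ℝ) : Euc d → ℝ :=
  l.foldr pderiv' φ

theorem pderivList_append (l l' : List (Fin d)) (φ : Euc d → ℝ) :
    pderivList (l ++ l') φ = pderivList l (pderivList l' φ) :=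
  List.foldr_append

theorem contDiff_pderiv' {φ : Euc d → ℝ} {n : ℕ} (i : Fin d)
    (h : ContDiff ℝ ((n + 1 : ℕ) : WithTop ℕ∞) φ) : ContDiff ℝ (n : WithTop ℕ∞) (pderiv' i φ) := by
  have h' : ContDiff ℝ (n : WithTop ℕ∞) (fderiv ℝ φ) :=
    h.fderiv_right (by push_cast; exact le_rfl)
  exact h'.clm_apply contDiff_const

theorem contDiff_pderivList {φ : Euc d → ℝ} {n : ℕ} (l : List (Fin d))
    (h : ContDiff ℝ ((n + l.length : ℕ) : WithTop ℕ∞) φ) :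
    ContDiff ℝ (n : WithTop ℕ∞) (pderivList l φ) := by
  induction l generalizing n with
  | nil => simpa [pderivList] using h
  | cons i l ih =>
    refine contDiff_pderiv' i (ih ?_)
    rw [List.length_cons] at h
    rwa [show n + 1 + l.length = n + (l.length + 1) by omega]

/-- Symmetry of second partial derivatives. -/
theorem pderiv'_comm {φ : Euc d → ℝ} (h : ContDiff ℝ 2 φ) (i j : Fin d) :
    pderiv' i (pderiv' j φ) = pderiv' j (pderiv' i φ) := by
  have hd : Differentiable ℝ (fderiv ℝ φ) :=
    (h.fderiv_right (m := 1) (by norm_num)).differentiable (by norm_num)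
  have key (a b : Fin d) (y : Euc d) : pderiv' a (pderiv' b φ) y =
      fderiv ℝ (fderiv ℝ φ) y (EuclideanSpace.single a 1) (EuclideanSpace.single b 1) := by
    unfold pderiv'
    rw [fderiv_clm_apply (hd y) (differentiableAt_const _)]
    simp
  funext y
  rw [key, key]
  exact (h.contDiffAt.isSymmSndFDerivAt (by simp)) _ _

theorem pderivList_perm {l l' : List (Fin d)} (hl : l.Perm l') {φ : Euc d → ℝ} {n : ℕ}
    (hn : l.length ≤ n) (h : ContDiff ℝ (n : WithTop ℕ∞) φ) :
    pderivList l φ = pderivList l' φ := by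
  induction hl with
  | nil => rfl
  | cons a _ ih =>
    rw [List.length_cons] at hn
    exact congrArg (pderiv' a) (ih (by omega))
  | swap a b l =>
    simp only [List.length_cons] at hn
    refine pderiv'_comm (φ := pderivList l φ) ?_ b a
    exact contDiff_pderivList (n := 2) l (h.of_le (by exact_mod_cast (by omega)))
  | trans h₁ _ ih₁ ih₂ => exact (ih₁ hn).trans (ih₂ (h₁.length_eq ▸ hn))

/-- The sorted list of directions attached to a multi-index. -/
def multiIndexList (α : Fin d → ℕ) : List (Fin d) :=
  (List.ofFn fun i => List.replicate (α i) i).flatten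

theorem Dmulti_eq_pderivList (α : Fin d → ℕ) (φ : Euc d → ℝ) :
    Dmulti α φ = pderivList (multiIndexList α) φ := by
  have hrep (i : Fin d) (n : ℕ) (ψ : Euc d → ℝ) :
      (fun ψ : Euc d → ℝ => pderiv' i ψ)^[n] ψ = pderivList (List.replicate n i) ψ := by
    induction n with
    | zero => rfl
    | succ n ih => rw [Function.iterate_succ_apply', ih]; rfl
  have key (L : List (Fin d)) :
      (L.map fun i => (fun ψ : Euc d → ℝ => pderiv' i ψ)^[α i]).foldr (· ∘ ·) id φ =
        pderivList (L.map fun i => List.replicate (α i) i).flatten φ := by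
    induction L with
    | nil => rfl
    | cons i L ih =>
      simp only [List.map_cons, List.foldr_cons, List.flatten_cons, pderivList_append,
        Function.comp_apply, ih, hrep]
  unfold Dmulti multiIndexList
  rw [List.ofFn_eq_map, List.ofFn_eq_map]
  exact key _

theorem count_multiIndexList (α : Fin d → ℕ) (i : Fin d) :
    (multiIndexList α).count i = α i := by
  simp [multiIndexList, List.count_flatten, List.map_ofFn, List.sum_ofFn, List.count_replicate]

theorem pderivList_eq_Dmulti {φ : Euc d → ℝ} {n : ℕ} (l : List (Fin d)) (hn : l.length ≤ n)
    (h : ContDiff ℝ (n : WithTop ℕ∞) φ) :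
    pderivList l φ = Dmulti (fun i => l.count i) φ := by
  rw [Dmulti_eq_pderivList]
  refine pderivList_perm (List.perm_iff_count.2 fun i => ?_) hn h
  rw [count_multiIndexList]

theorem sum_count_eq_length (l : List (Fin d)) : ∑ i, l.count i = l.length := by
  simpa using Multiset.sum_count_eq_card (s := Finset.univ) (m := (l : Multiset (Fin d)))
    (fun a _ => Finset.mem_univ a)

theorem count_mem_multiIdx3 {l : List (Fin d)} (hl : l.length ≤ 3) :
    (fun i => l.count i) ∈ multiIdx3 d := by
  simp only [multiIdx3, Finset.mem_filter, Fintype.mem_piFinset, Finset.mem_range]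
  exact ⟨fun i => (List.count_le_length.trans hl).trans_lt (by norm_num),
    (sum_count_eq_length l).trans_le hl⟩

theorem hasDerivAt_line {ψ : Euc d → ℝ} (hψ : Differentiable ℝ ψ) (x h : Euc d) (t : ℝ) :
    HasDerivAt (fun t : ℝ => ψ (x + t • h)) (∑ i, h i * pderiv' i ψ (x + t • h)) t := by
  have h1 : HasDerivAt (fun t : ℝ => x + t • h) h t := by
    simpa using ((hasDerivAt_id t).smul_const h).const_add x
  have h2 := (hψ (x + t • h)).hasFDerivAt.comp_hasDerivAt t h1
  have hh : h = ∑ i, h i • EuclideanSpace.single i (1 : ℝ) := by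
    simpa using ((EuclideanSpace.basisFun (Fin d) ℝ).sum_repr h).symm
  refine h2.congr_deriv ?_
  generalize x + t • h = y
  conv_lhs => rw [hh]
  simp only [pderiv', map_sum, map_smul, smul_eq_mul]

theorem taylor_second_order_bound {g g₁ g₂ g₃ : ℝ → ℝ} {K : ℝ}
    (h₀ : ∀ t, HasDerivAt g (g₁ t) t) (h₁ : ∀ t, HasDerivAt g₁ (g₂ t) t)
    (h₂ : ∀ t, HasDerivAt g₂ (g₃ t) t) (hK : ∀ t, |g₃ t| ≤ K) :
    |g 1 - g 0 - g₁ 0 - g₂ 0 / 2| ≤ K := by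
  have hK0 : 0 ≤ K := (abs_nonneg _).trans (hK 0)
  have mv (u u' : ℝ → ℝ) (hu : ∀ t, HasDerivAt u (u' t) t) (hb : ∀ t ∈ Icc (0:ℝ) 1, |u' t| ≤ K)
      (t : ℝ) (ht : t ∈ Icc (0:ℝ) 1) : |u t - u 0| ≤ K := by
    have := norm_image_sub_le_of_norm_deriv_le_segment' (f := u) (f' := u') (C := K) (a := 0)
      (b := 1) (fun s _ => (hu s).hasDerivWithinAt) (fun s hs => hb s ⟨hs.1, hs.2.le⟩) t ht
    rw [Real.norm_eq_abs] at this
    nlinarith [ht.1, ht.2]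
  have e₂ := mv g₂ g₃ h₂ (fun t _ => hK t)
  have e₁ := mv (fun t => g₁ t - t * g₂ 0) (fun t => g₂ t - g₂ 0)
    (fun t => ((h₁ t).sub ((hasDerivAt_id t).mul_const (g₂ 0))).congr_deriv (by simp)) e₂
  have e₀ := mv (fun t => g t - t * g₁ 0 - t ^ 2 / 2 * g₂ 0) (fun t => g₁ t - g₁ 0 - t * g₂ 0)
    (fun t => by
      have := ((h₀ t).sub ((hasDerivAt_id t).mul_const (g₁ 0))).sub
        ((((hasDerivAt_id t).pow 2).div_const 2).mul_const (g₂ 0))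
      refine this.congr_deriv ?_
      simp)
    (fun t ht => by
      have := e₁ t ht
      simp only [zero_mul, sub_zero] at this
      convert this using 2
      ring)
    1 (by simp)
  convert e₀ using 2
  ring

/-- The quadratic form of a matrix. -/
def quadForm (X : Matrix (Fin d) (Fin d) ℝ) (w : Euc d) : ℝ :=
  ∑ i, ∑ j, w i * X i j * w j

theorem abs_coord_le_norm (h : Euc d) (i : Fin d) : |h i| ≤ ‖h‖ := by
  simpa using PiLp.norm_apply_le h i

theorem taylor_multivariate {φ : Euc d → ℝ} (hφ : ContDiff ℝ 3 φ) {M : ℝ}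
    (hM : ∀ (i j k : Fin d) (y : Euc d), |pderiv' k (pderiv' j (pderiv' i φ)) y| ≤ M)
    (x h : Euc d) :
    |φ (x + h) - φ x - ∑ i, h i * pderiv' i φ x - quadForm (hessian φ x) h / 2| ≤
      d ^ 3 * M * ‖h‖ ^ 3 := by
  have c₁ (i) : ContDiff ℝ 2 (pderiv' i φ) := contDiff_pderiv' (n := 2) i (by exact_mod_cast hφ)
  have c₂ (i j) : ContDiff ℝ 1 (pderiv' j (pderiv' i φ)) :=
    contDiff_pderiv' (n := 1) j (by exact_mod_cast c₁ i)
  have key := taylor_second_order_bound (K := d ^ 3 * M * ‖h‖ ^ 3)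
    (g := fun t => φ (x + t • h))
    (g₁ := fun t => ∑ i, h i * pderiv' i φ (x + t • h))
    (g₂ := fun t => ∑ i, h i * ∑ j, h j * pderiv' j (pderiv' i φ) (x + t • h))
    (g₃ := fun t => ∑ i, h i * ∑ j, h j * ∑ k, h k *
      pderiv' k (pderiv' j (pderiv' i φ)) (x + t • h))
    (fun t => hasDerivAt_line (hφ.differentiable (by norm_num)) x h t)
    (fun t => HasDerivAt.fun_sum fun i _ =>
      (hasDerivAt_line ((c₁ i).differentiable (by norm_num)) x h t).const_mul _)
    (fun t => HasDerivAt.fun_sum fun i _ => (HasDerivAt.fun_sum fun j _ =>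
      (hasDerivAt_line ((c₂ i j).differentiable (by norm_num)) x h t).const_mul _).const_mul _)
    (fun t => ?_)
  · simp only [one_smul, zero_smul, add_zero] at key
    convert key using 5
    rw [quadForm, Finset.sum_comm]
    refine Finset.sum_congr rfl fun i _ => ?_
    rw [Finset.mul_sum]
    refine Finset.sum_congr rfl fun j _ => ?_
    rw [show hessian φ x j i = pderiv' j (pderiv' i φ) x from rfl]
    ring
  · have step (a : Fin d → ℝ) (K : ℝ) (ha : ∀ i, |a i| ≤ K) :
        |∑ i, h i * a i| ≤ d * (‖h‖ * K) := by
      refine (Finset.abs_sum_le_sum_abs _ _).trans ?_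
      refine (Finset.sum_le_card_nsmul _ _ (‖h‖ * K) fun i _ => ?_).trans (by simp)
      rw [abs_mul]
      exact mul_le_mul (abs_coord_le_norm h i) (ha i) (abs_nonneg _) (norm_nonneg _)
    refine (step _ _ fun i => step _ _ fun j => step _ _ fun k => hM i j k _).trans (le_of_eq ?_)
    ring

theorem gradient_apply {φ : Euc d → ℝ} {x : Euc d} (i : Fin d) :
    gradient φ x i = pderiv' i φ x := by
  have : inner ℝ (gradient φ x) (EuclideanSpace.single i (1:ℝ)) = pderiv' i φ x := by
    simp [gradient, pderiv']
  rw [← this, EuclideanSpace.inner_single_right]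
  simp

theorem hessian_isSymm {φ : Euc d → ℝ} (hφ : ContDiff ℝ 2 φ) (x : Euc d) :
    (hessian φ x).IsSymm := by
  ext i j
  exact congrFun (pderiv'_comm hφ j i) x

theorem abs_quadForm_le (X : Matrix (Fin d) (Fin d) ℝ) (w : Euc d) :
    |quadForm X w| ≤ frobNorm X * ‖w‖ ^ 2 := by
  have h := Finset.sum_mul_sq_le_sq_mul_sq (Finset.univ : Finset (Fin d × Fin d))
    (fun k => X k.1 k.2) (fun k => w k.1 * w k.2)
  simp only [Fintype.sum_prod_type, mul_pow, ← Finset.mul_sum, ← Finset.sum_mul] at h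
  have hq : ∑ i, ∑ j, X i j * (w i * w j) = quadForm X w :=
    Finset.sum_congr rfl fun i _ => Finset.sum_congr rfl fun j _ => by ring
  have hw : ∑ i, w i ^ 2 = ‖w‖ ^ 2 := by simp [EuclideanSpace.norm_sq_eq]
  rw [hq, hw] at h
  refine abs_le_of_sq_le_sq ?_ (mul_nonneg (Real.sqrt_nonneg _) (by positivity))
  rw [mul_pow, frobNorm, Real.sq_sqrt (by positivity)]
  linarith

theorem quadForm_smul (X : Matrix (Fin d) (Fin d) ℝ) (c : ℝ) (w : Euc d) :
    quadForm X (c • w) = c ^ 2 * quadForm X w := by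
  simp only [quadForm, Finset.mul_sum, PiLp.smul_apply, smul_eq_mul]
  exact Finset.sum_congr rfl fun i _ => Finset.sum_congr rfl fun j _ => by ring

theorem quadForm_sub (X X' : Matrix (Fin d) (Fin d) ℝ) (w : Euc d) :
    quadForm (X - X') w = quadForm X w - quadForm X' w := by
  simp only [quadForm, ← Finset.sum_sub_distrib, Matrix.sub_apply]
  exact Finset.sum_congr rfl fun i _ => Finset.sum_congr rfl fun j _ => by ring

theorem quadForm_parallelogram (X : Matrix (Fin d) (Fin d) ℝ) (w u : Euc d) :
    quadForm X (w + u) + quadForm X (w - u) = 2 * quadForm X w + 2 * quadForm X u := by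
  simp only [quadForm, Finset.mul_sum, ← Finset.sum_add_distrib, PiLp.add_apply, PiLp.sub_apply]
  exact Finset.sum_congr rfl fun i _ => Finset.sum_congr rfl fun j _ => by ring

theorem continuous_quadForm (X : Matrix (Fin d) (Fin d) ℝ) : Continuous (quadForm X) := by
  unfold quadForm
  fun_prop

/-- A symmetric matrix becomes positive semidefinite after adding `μ`, where `-μ ≤ 0` is the
minimum of its quadratic form on the unit ball. -/
theorem exists_shift_posSemidef {Y : Matrix (Fin d) (Fin d) ℝ} (hY : Y.IsSymm) :
    ∃ μ : ℝ, 0 ≤ μ ∧ ∃ v : Euc d, ‖v‖ ≤ 1 ∧ quadForm Y v = -μ ∧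
      (Y + μ • (1 : Matrix (Fin d) (Fin d) ℝ)).PosSemidef := by
  obtain ⟨v, hv, hmin⟩ := (isCompact_closedBall (0 : Euc d) 1).exists_isMinOn
    ⟨0, by simp⟩ (continuous_quadForm Y).continuousOn
  have h0 : quadForm Y v ≤ 0 := by
    have := hmin (show (0 : Euc d) ∈ Metric.closedBall 0 1 by simp)
    simpa [quadForm] using this
  refine ⟨-quadForm Y v, by linarith, v, by simpa using hv, by ring, ?_⟩
  have hlow (w : Euc d) : quadForm Y v * ‖w‖ ^ 2 ≤ quadForm Y w := by
    rcases eq_or_ne w 0 with rfl | hw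
    · simp [quadForm]
    · have hn : 0 < ‖w‖ := norm_pos_iff.2 hw
      have := hmin (show ‖w‖⁻¹ • w ∈ Metric.closedBall (0 : Euc d) 1 by
        simp [norm_smul, hn.ne'])
      simp only [mem_ofPred_eq, quadForm_smul] at this
      calc quadForm Y v * ‖w‖ ^ 2 ≤ (‖w‖⁻¹ ^ 2 * quadForm Y w) * ‖w‖ ^ 2 := by gcongr
        _ = quadForm Y w := by field_simp
  refine Matrix.PosSemidef.of_dotProduct_mulVec_nonneg ?_ fun u => ?_
  · rw [Matrix.IsHermitian, Matrix.conjTranspose_eq_transpose_of_trivial]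
    exact hY.add (Matrix.isSymm_one.smul _)
  · have h := hlow (WithLp.toLp 2 u)
    have e₁ : u ⬝ᵥ Y.mulVec u = quadForm Y (WithLp.toLp 2 u) := by
      simp only [dotProduct, Matrix.mulVec, quadForm, Finset.mul_sum]
      exact Finset.sum_congr rfl fun i _ => Finset.sum_congr rfl fun j _ => by ring
    have e₂ : u ⬝ᵥ u = ‖WithLp.toLp 2 u‖ ^ 2 := by
      rw [EuclideanSpace.norm_sq_eq]
      simp [dotProduct, sq]
    rw [star_trivial, Matrix.add_mulVec, dotProduct_add, Matrix.smul_mulVec, Matrix.one_mulVec,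
      dotProduct_smul, e₁, e₂, smul_eq_mul]
    linarith

theorem frobNorm_smul_one_le {μ : ℝ} (hμ : 0 ≤ μ) :
    frobNorm (μ • (1 : Matrix (Fin d) (Fin d) ℝ)) ≤ d * μ := by
  refine Real.sqrt_le_iff.2 ⟨by positivity, ?_⟩
  have : ∑ i, ∑ j, ((μ • (1 : Matrix (Fin d) (Fin d) ℝ)) i j) ^ 2 = d * μ ^ 2 := by
    simp [Matrix.one_apply, ite_pow]
  rw [this, mul_pow]
  have hd : (d : ℝ) ≤ d ^ 2 := by exact_mod_cast Nat.le_self_pow (by norm_num) d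
  gcongr

theorem sum_pairs_le {B : (Fin d → ℕ) → ℝ} (hB : ∀ α ∈ multiIdx3 d, 0 ≤ B α) :
    ∑ i, ∑ j, B (fun k => [i, j].count k) ≤
      2 * ∑ α ∈ multiIdx3 d with ∑ k, α k = 2, B α := by
  have hmaps : ∀ q ∈ (Finset.univ : Finset (Fin d × Fin d)),
      (fun k => [q.1, q.2].count k) ∈ (multiIdx3 d).filter fun α => ∑ k, α k = 2 := fun q _ =>
    Finset.mem_filter.2 ⟨count_mem_multiIdx3 (by simp), sum_count_eq_length _⟩
  rw [← Fintype.sum_prod_type' (f := fun i j => B (fun k => [i, j].count k)),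
    ← Finset.sum_fiberwise_of_maps_to hmaps, Finset.mul_sum]
  refine Finset.sum_le_sum fun α hα => ?_
  have hα0 : 0 ≤ B α := hB α (Finset.mem_filter.1 hα).1
  rw [Finset.sum_congr rfl (g := fun _ => B α)
    fun q hq => congrArg B (Finset.mem_filter.1 hq).2, Finset.sum_const, nsmul_eq_mul]
  refine mul_le_mul_of_nonneg_right ?_ hα0
  rcases Finset.eq_empty_or_nonempty
    (Finset.univ.filter fun q : Fin d × Fin d => (fun k => [q.1, q.2].count k) = α)
    with h | ⟨⟨a, b⟩, h⟩
  · rw [h]; norm_num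
  · refine (Nat.cast_le.2 (Finset.card_le_card (t := {(a, b), (b, a)}) ?_)).trans
      (by exact_mod_cast Finset.card_le_two)
    rintro ⟨i, j⟩ hq
    have hperm : [i, j].Perm [a, b] := List.perm_iff_count.2 fun k =>
      (congrFun (Finset.mem_filter.1 hq).2 k).trans (congrFun (Finset.mem_filter.1 h).2 k).symm
    have hi : i = a ∨ i = b := by simpa using hperm.subset (List.mem_cons_self (a := i))
    rcases hi with rfl | rfl
    · simp [List.singleton_perm_singleton.1 ((List.perm_cons _).1 hperm)]
    · simp [List.singleton_perm_singleton.1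
        ((List.perm_cons _).1 (hperm.trans (List.Perm.swap i a [])))]

theorem sqrt_sum_sq_le_sum {ι : Type*} (s : Finset ι) {a b : ι → ℝ} (h : ∀ i ∈ s, |a i| ≤ b i) :
    √(∑ i ∈ s, a i ^ 2) ≤ ∑ i ∈ s, b i := by
  have hb : ∀ i ∈ s, 0 ≤ b i := fun i hi => (abs_nonneg _).trans (h i hi)
  refine Real.sqrt_le_iff.2 ⟨Finset.sum_nonneg hb, ?_⟩
  refine (Finset.sum_le_sum fun i hi => ?_).trans (Finset.sum_sq_le_sq_sum_of_nonneg hb)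
  exact sq_le_sq' (by linarith [(abs_le.1 (h i hi)).1]) (abs_le.1 (h i hi)).2

/-- A derivative at a point is controlled by the sup norms of the function and of its
second derivative. -/
theorem abs_deriv_le_of_bounds {g g₁ g₂ : ℝ → ℝ} {G K : ℝ}
    (h₀ : ∀ t, HasDerivAt g (g₁ t) t) (h₁ : ∀ t, HasDerivAt g₁ (g₂ t) t)
    (hG : ∀ t, |g t| ≤ G) (hK : ∀ t, |g₂ t| ≤ K) : |g₁ 0| ≤ 2 * G + K := by
  have hK0 : 0 ≤ K := (abs_nonneg _).trans (hK 0)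
  obtain ⟨c, hc, hceq⟩ := exists_hasDerivAt_eq_slope g g₁ one_pos
    (fun t _ => (h₀ t).continuousAt.continuousWithinAt) (fun t _ => h₀ t)
  have h := norm_image_sub_le_of_norm_deriv_le_segment' (f := g₁) (f' := g₂) (C := K) (a := 0)
    (b := 1) (fun s _ => (h₁ s).hasDerivWithinAt) (fun s _ => hK s) c ⟨hc.1.le, hc.2.le⟩
  rw [Real.norm_eq_abs] at h
  have hc1 : K * (c - 0) ≤ K := by nlinarith [hc.1, hc.2]
  have a₀ := abs_le.1 (hG 0)
  have a₁ := abs_le.1 (hG 1)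
  have a₂ := abs_le.1 (h.trans hc1)
  norm_num at hceq
  rw [abs_le]
  constructor <;> linarith [a₀.1, a₀.2, a₁.1, a₁.2, a₂.1, a₂.2]

theorem abs_pderivList_le {φ : Euc d → ℝ} (hφ : ContDiff ℝ 3 φ) {B : (Fin d → ℕ) → ℝ}
    (hB : ∀ α ∈ multiIdx3 d, ∀ y : Euc d, |Dmulti α φ y| ≤ B α) {l : List (Fin d)}
    (hl : l.length ≤ 3) (y : Euc d) : |pderivList l φ y| ≤ B fun i => l.count i := by
  rw [pderivList_eq_Dmulti (n := 3) l hl (by exact_mod_cast hφ)]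
  exact hB _ (count_mem_multiIdx3 hl) y

theorem norm_gradient_le {φ : Euc d → ℝ} (hφ : ContDiff ℝ 3 φ) {B : (Fin d → ℕ) → ℝ}
    (hB : ∀ α ∈ multiIdx3 d, ∀ y : Euc d, |Dmulti α φ y| ≤ B α) (x : Euc d) :
    ‖gradient φ x‖ ≤ ∑ α ∈ multiIdx3 d, B α := by
  have hB0 : ∀ α ∈ multiIdx3 d, 0 ≤ B α := fun α hα => (abs_nonneg _).trans (hB α hα x)
  have hinj : Function.Injective fun (i k : Fin d) => [i].count k := fun i j hij => by
    have := List.perm_iff_count.2 fun k => congrFun hij k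
    exact List.singleton_perm_singleton.1 this
  rw [EuclideanSpace.norm_eq]
  calc _ ≤ ∑ i, B (fun k => [i].count k) := by
        simp only [Real.norm_eq_abs, sq_abs]
        refine sqrt_sum_sq_le_sum _ fun i _ => ?_
        rw [gradient_apply]
        exact abs_pderivList_le hφ hB (l := [i]) (by simp) x
    _ = ∑ α ∈ Finset.univ.image (fun (i k : Fin d) => [i].count k), B α :=
        (Finset.sum_image hinj.injOn).symm
    _ ≤ _ := by
        refine Finset.sum_le_sum_of_subset_of_nonneg ?_ fun α hα _ => hB0 α hα
        intro α hα
        obtain ⟨i, -, rfl⟩ := Finset.mem_image.1 hα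
        exact count_mem_multiIdx3 (by simp)

/-- The Frobenius norm counts mixed second derivatives twice, but the surplus is absorbed by the
first and third order derivatives. -/
theorem frobNorm_hessian_le {φ : Euc d → ℝ} (hφ : ContDiff ℝ 3 φ) {B : (Fin d → ℕ) → ℝ}
    (hB : ∀ α ∈ multiIdx3 d, ∀ y : Euc d, |Dmulti α φ y| ≤ B α) (x : Euc d) :
    frobNorm (hessian φ x) ≤ ∑ α ∈ multiIdx3 d, B α := by
  have hB0 : ∀ α ∈ multiIdx3 d, 0 ≤ B α := fun α hα => (abs_nonneg _).trans (hB α hα x)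
  set S := ∑ α ∈ multiIdx3 d with ∑ k, α k = 2, B α
  set E := ∑ α ∈ multiIdx3 d with ¬ ∑ k, α k = 2, B α with hE
  have hSE : S + E = ∑ α ∈ multiIdx3 d, B α := Finset.sum_filter_add_sum_filter_not _ _ _
  have hS : 0 ≤ S := Finset.sum_nonneg fun α hα => hB0 α (Finset.mem_filter.1 hα).1
  have hE0 : 0 ≤ E := Finset.sum_nonneg fun α hα => hB0 α (Finset.mem_filter.1 hα).1
  have hsecond (i j : Fin d) : |hessian φ x i j| ≤ 2 * E := by
    have hc : ContDiff ℝ 2 (pderiv' j φ) := contDiff_pderiv' (n := 2) j (by exact_mod_cast hφ)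
    have hc' : ContDiff ℝ 1 (pderiv' i (pderiv' j φ)) :=
      contDiff_pderiv' (n := 1) i (by exact_mod_cast hc)
    have hline {ψ : Euc d → ℝ} (hψ : Differentiable ℝ ψ) (t : ℝ) :
        HasDerivAt (fun t : ℝ => ψ (x + t • EuclideanSpace.single i (1 : ℝ)))
          (pderiv' i ψ (x + t • EuclideanSpace.single i (1 : ℝ))) t := by
      have h := hasDerivAt_line hψ x (EuclideanSpace.single i (1 : ℝ)) t
      simpa [Pi.single_apply] using h
    have h := abs_deriv_le_of_bounds (hline (hc.differentiable (by norm_num)))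
      (hline (hc'.differentiable (by norm_num)))
      (fun t => abs_pderivList_le hφ hB (l := [j]) (by simp) _)
      (fun t => abs_pderivList_le hφ hB (l := [i, i, j]) (by simp) _)
    simp only [zero_smul, add_zero] at h
    refine (show |hessian φ x i j| ≤ _ from h).trans ?_
    have hne : (fun k => [j].count k) ≠ fun k => [i, i, j].count k := fun he => by
      simpa [sum_count_eq_length] using congrArg (fun α : Fin d → ℕ => ∑ k, α k) he
    have hsub : ({(fun k => [j].count k), fun k => [i, i, j].count k} : Finset (Fin d → ℕ)) ⊆
        (multiIdx3 d).filter fun α => ¬ ∑ k, α k = 2 := by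
      intro α hα
      rcases Finset.mem_insert.1 hα with rfl | hα
      · exact Finset.mem_filter.2 ⟨count_mem_multiIdx3 (by simp), by simp [sum_count_eq_length]⟩
      · rw [Finset.mem_singleton.1 hα]
        exact Finset.mem_filter.2 ⟨count_mem_multiIdx3 (by simp), by simp [sum_count_eq_length]⟩
    have hle := Finset.sum_le_sum_of_subset_of_nonneg (f := B) hsub
      fun α hα _ => hB0 α (Finset.mem_filter.1 hα).1
    rw [Finset.sum_pair hne, ← hE] at hle
    have h3 := hB0 _ (count_mem_multiIdx3 (l := [i, i, j]) (by simp))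
    linarith
  rw [← hSE]
  refine Real.sqrt_le_iff.2 ⟨add_nonneg hS hE0, ?_⟩
  calc ∑ i, ∑ j, hessian φ x i j ^ 2
      ≤ ∑ i, ∑ j, 2 * E * B (fun k => [i, j].count k) := by
        refine Finset.sum_le_sum fun i _ => Finset.sum_le_sum fun j _ => ?_
        rw [← sq_abs, sq]
        exact mul_le_mul (hsecond i j) (abs_pderivList_le hφ hB (l := [i, j]) (by simp) x)
          (abs_nonneg _) (by positivity)
    _ = 2 * E * ∑ i, ∑ j, B (fun k => [i, j].count k) := by simp only [Finset.mul_sum]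
    _ ≤ 2 * E * (2 * S) := by gcongr; exact sum_pairs_le hB0
    _ ≤ (S + E) ^ 2 := by nlinarith [sq_nonneg (S - E)]

theorem sum_mul_eq_inner (w p : Euc d) : ∑ i, w i * p i = inner ℝ p w := by
  simp [PiLp.inner_apply]

/-- Consequence of the degenerate ellipticity and Lipschitz bounds: a change of the last two
arguments costs at most the gradient gap plus the negative part of the Hessian gap. -/
theorem nonlinearity_sub_le {T C₀ : ℝ}
    {F : ℝ → Euc d → ℝ → Euc d → Matrix (Fin d) (Fin d) ℝ → ℝ} (hC₀ : 0 ≤ C₀)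
    (hF : Assumption41F T C₀ F) {t : ℝ} (ht : t ∈ Icc (0:ℝ) T) (x : Euc d) (z : ℝ) (p q : Euc d)
    {X H : Matrix (Fin d) (Fin d) ℝ} (hX : X.IsSymm) (hH : H.IsSymm) {μ : ℝ} (hμ : 0 ≤ μ)
    (hpsd : (H - X + μ • (1 : Matrix (Fin d) (Fin d) ℝ)).PosSemidef) :
    F t x z q H - F t x z p X ≤ C₀ * ‖q - p‖ + C₀ * (d * μ) := by
  obtain ⟨hell, ⟨F₀, -, hlip⟩, -⟩ := hF
  have hH' : (H + μ • (1 : Matrix (Fin d) (Fin d) ℝ)).IsSymm :=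
    hH.add (Matrix.isSymm_one.smul _)
  have h₁ := hell t ht x z q _ X hH' hX (by rwa [add_sub_right_comm])
  have h₂ := (abs_le.1 (hlip t ht t ht x x z z q q _ H hH' hH)).1
  have h₃ := (abs_le.1 (hlip t ht t ht x x z z q p X X hX hX)).2
  have h₄ : frobNorm (0 : Matrix (Fin d) (Fin d) ℝ) = 0 := by simp [frobNorm]
  simp only [sub_self, abs_zero, norm_zero, zero_add, add_zero, add_sub_cancel_left, h₄] at h₂ h₃
  have h₅ := mul_le_mul_of_nonneg_left (frobNorm_smul_one_le (d := d) hμ) hC₀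
  linarith

/-- The two competing directions `w ± u`: `w` penalizes a wrong gradient and `u` penalizes a
Hessian gap with a negative direction. -/
theorem exists_penalizing_directions {C₀ C₂ s M : ℝ} (hC₀ : 0 < C₀) (hs : 0 < s) (hs2 : s ≤ 1 / 2)
    (hsC : 8 * C₀ * (d + 1) * s ≤ 1) (hM : M * s ^ 4 ≤ C₂) (r : Euc d)
    {H X : Matrix (Fin d) (Fin d) ℝ} (hH : frobNorm H ≤ M) (hX : frobNorm X ≤ M)
    {μ : ℝ} (hμ : 0 ≤ μ) {v : Euc d} (hv : ‖v‖ ≤ 1) (hquad : quadForm (H - X) v = -μ) :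
    ∃ w u : Euc d, ‖w + u‖ ≤ s⁻¹ ∧ ‖w - u‖ ≤ s⁻¹ ∧
      s ^ 10 * inner ℝ r w + s ^ 20 / 2 * (quadForm (H - X) w + quadForm (H - X) u) +
        s ^ 20 * (C₀ * ‖r‖ + C₀ * (d * μ)) ≤ C₂ * s ^ 22 := by
  have hM0 : 0 ≤ M := (Real.sqrt_nonneg _).trans hH
  have hC₂ : 0 ≤ C₂ := (by positivity : 0 ≤ M * s ^ 4).trans hM
  set n : Euc d := ‖r‖⁻¹ • r with hn
  have hnn : ‖n‖ ≤ 1 := by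
    rw [hn, norm_smul, norm_inv, norm_norm]
    exact inv_mul_le_one
  have hrn : inner ℝ r n = ‖r‖ := by
    rw [hn, inner_smul_right, real_inner_self_eq_norm_sq]
    rcases eq_or_ne ‖r‖ 0 with h | h
    · simp [h]
    · field_simp
  have hs5 : s ^ 5 ≤ s⁻¹ / 2 := by
    have : s ^ 6 ≤ 1 / 2 := by
      calc s ^ 6 ≤ s ^ 1 := pow_le_pow_of_le_one hs.le (by linarith) (by norm_num)
        _ ≤ 1 / 2 := by simpa using hs2
    rw [inv_eq_one_div, div_div, le_div_iff₀ (by positivity)]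
    nlinarith
  have hw : ‖(-s ^ 5) • n‖ ≤ s ^ 5 := by
    rw [norm_smul, norm_neg, Real.norm_of_nonneg (by positivity)]
    exact mul_le_of_le_one_right (by positivity) hnn
  have hu : ‖(s⁻¹ / 2) • v‖ ≤ s⁻¹ / 2 := by
    rw [norm_smul, Real.norm_of_nonneg (by positivity)]
    exact mul_le_of_le_one_right (by positivity) hv
  refine ⟨(-s ^ 5) • n, (s⁻¹ / 2) • v, (norm_add_le _ _).trans (by linarith),
    (norm_sub_le _ _).trans (by linarith), ?_⟩
  have hqw : quadForm (H - X) ((-s ^ 5) • n) ≤ 2 * M * s ^ 10 := by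
    have hsq : ‖(-s ^ 5) • n‖ ^ 2 ≤ s ^ 10 := by
      calc _ ≤ (s ^ 5) ^ 2 := by gcongr
        _ = s ^ 10 := by ring
    have b (Z : Matrix (Fin d) (Fin d) ℝ) (hZ : frobNorm Z ≤ M) :
        |quadForm Z ((-s ^ 5) • n)| ≤ M * s ^ 10 :=
      (abs_quadForm_le _ _).trans (mul_le_mul hZ hsq (by positivity) hM0)
    rw [quadForm_sub]
    linarith [(abs_le.1 (b H hH)).2, (abs_le.1 (b X hX)).1]
  rw [quadForm_smul _ (s⁻¹ / 2), hquad, inner_smul_right, hrn]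
  have hd : (0 : ℝ) ≤ d := Nat.cast_nonneg d
  have hC₀s : C₀ * s ≤ 1 / 8 := by nlinarith [mul_nonneg (mul_nonneg hC₀.le hd) hs.le]
  have hC₀d : C₀ * d * s ≤ 1 / 8 := by nlinarith [mul_pos hC₀ hs]
  have t₁ : s ^ 20 * (C₀ * ‖r‖) ≤ s ^ 15 * ‖r‖ := by
    have : s ^ 5 * C₀ ≤ 1 := by
      have : s ^ 4 ≤ 1 := pow_le_one₀ hs.le (by linarith)
      nlinarith [mul_pos hC₀ hs]
    calc s ^ 20 * (C₀ * ‖r‖) = (s ^ 5 * C₀) * (s ^ 15 * ‖r‖) := by ring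
      _ ≤ s ^ 15 * ‖r‖ := mul_le_of_le_one_left (by positivity) this
  have t₂ : s ^ 20 * (C₀ * (d * μ)) ≤ s ^ 18 * μ / 8 := by
    have : s ^ 2 * (C₀ * d) ≤ 1 / 8 := by nlinarith [mul_nonneg (mul_nonneg hC₀.le hd) hs.le]
    calc s ^ 20 * (C₀ * (d * μ)) = (s ^ 2 * (C₀ * d)) * (s ^ 18 * μ) := by ring
      _ ≤ 1 / 8 * (s ^ 18 * μ) := by gcongr
      _ = _ := by ring
  have t₃ : s ^ 20 / 2 * quadForm (H - X) ((-s ^ 5) • n) ≤ C₂ * s ^ 22 := by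
    calc _ ≤ s ^ 20 / 2 * (2 * M * s ^ 10) := by gcongr
      _ = (M * s ^ 4) * s ^ 26 := by ring
      _ ≤ C₂ * s ^ 22 := mul_le_mul hM
        (pow_le_pow_of_le_one hs.le (by linarith) (by norm_num)) (by positivity) hC₂
  have t₄ : s ^ 20 / 2 * ((s⁻¹ / 2) ^ 2 * -μ) = -(s ^ 18 * μ / 8) := by
    field_simp
    ring
  have t₅ : s ^ 10 * (-s ^ 5 * ‖r‖) = -(s ^ 15 * ‖r‖) := by ring
  rw [mul_add (s ^ 20 / 2), t₄, t₅, mul_add (s ^ 20)]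
  linarith

/-- The max–min representation in the scale `s = δ ^ (1 / 20)`. -/
theorem maxmin_representation_scaled {T C₀ C₂ s M : ℝ}
    {F : ℝ → Euc d → ℝ → Euc d → Matrix (Fin d) (Fin d) ℝ → ℝ} (hF : Assumption41F T C₀ F)
    (hC₀ : 0 < C₀) (hs : 0 < s) (hs2 : s ≤ 1 / 2) (hsC : 8 * C₀ * (d + 1) * s ≤ 1)
    (hM : M * s ^ 4 ≤ C₂) {t : ℝ} (ht : t ∈ Icc (0:ℝ) T) (x : Euc d) (z : ℝ) {φ : Euc d → ℝ}
    (hφ : ContDiff ℝ 3 φ) {B : (Fin d → ℕ) → ℝ}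
    (hB : ∀ α ∈ multiIdx3 d, ∀ y : Euc d, |Dmulti α φ y| ≤ B α)
    (hBM : ∑ α ∈ multiIdx3 d, B α ≤ M) :
    |φ x - s ^ 20 * F t x z (gradient φ x) (hessian φ x) -
      sSup {a : ℝ | ∃ (p : Euc d) (X : Matrix (Fin d) (Fin d) ℝ),
        X.IsSymm ∧ ‖p‖ ≤ M ∧ frobNorm X ≤ M ∧
        a = sInf {b : ℝ | ∃ w : Euc d, ‖w‖ ≤ s⁻¹ ∧
          b = φ (x + s ^ 10 • w) - s ^ 10 * (∑ i, w i * p i) -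
            (s ^ 20 / 2) * (∑ i, ∑ j, w i * X i j * w j) - s ^ 20 * F t x z p X}}|
      ≤ (d ^ 3 + 1) * C₂ * s ^ 22 := by
  set q := gradient φ x with hq
  set H := hessian φ x
  have hHs : H.IsSymm := hessian_isSymm (hφ.of_le (by norm_num)) x
  have hqM : ‖q‖ ≤ M := (norm_gradient_le hφ hB x).trans hBM
  have hHM : frobNorm H ≤ M := (frobNorm_hessian_le hφ hB x).trans hBM
  have hM0 : 0 ≤ M := (norm_nonneg _).trans hqM
  have hC₂ : 0 ≤ C₂ := (by positivity : 0 ≤ M * s ^ 4).trans hM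
  have hthird (i j k : Fin d) (y : Euc d) : |pderiv' k (pderiv' j (pderiv' i φ)) y| ≤ M :=
    (abs_pderivList_le hφ hB (l := [k, j, i]) (by simp) y).trans <|
      (Finset.single_le_sum (fun α hα => (abs_nonneg _).trans (hB α hα x))
        (count_mem_multiIdx3 (by simp))).trans hBM
  have htaylor (w : Euc d) (hw : ‖w‖ ≤ s⁻¹) :
      |φ (x + s ^ 10 • w) - φ x - s ^ 10 * inner ℝ q w - s ^ 20 / 2 * quadForm H w| ≤
        d ^ 3 * C₂ * s ^ 22 := by
    have h := taylor_multivariate hφ hthird x (s ^ 10 • w)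
    have e : ∑ i, (s ^ 10 • w) i * pderiv' i φ x = s ^ 10 * inner ℝ q w := by
      simp only [← gradient_apply, sum_mul_eq_inner, inner_smul_right, hq]
    rw [e, quadForm_smul, norm_smul, Real.norm_of_nonneg (by positivity)] at h
    calc _ = _ := by congr 1; ring
      _ ≤ _ := h
      _ ≤ d ^ 3 * M * (s ^ 10 * s⁻¹) ^ 3 := by gcongr
      _ = d ^ 3 * ((M * s ^ 4) * s ^ 23) := by field_simp
      _ ≤ d ^ 3 * (C₂ * s ^ 22) := by
        gcongr ?_ * ?_
        exact mul_le_mul hM (pow_le_pow_of_le_one hs.le (by linarith) (by norm_num))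
          (by positivity) hC₂
      _ = _ := by ring
  set f : Euc d → Matrix (Fin d) (Fin d) ℝ → Euc d → ℝ := fun p X w =>
    φ (x + s ^ 10 • w) - s ^ 10 * inner ℝ p w - (s ^ 20 / 2) * quadForm X w -
      s ^ 20 * F t x z p X with hf
  have hset (p : Euc d) (X : Matrix (Fin d) (Fin d) ℝ) : {b : ℝ | ∃ w : Euc d, ‖w‖ ≤ s⁻¹ ∧
      b = φ (x + s ^ 10 • w) - s ^ 10 * (∑ i, w i * p i) -
        (s ^ 20 / 2) * (∑ i, ∑ j, w i * X i j * w j) - s ^ 20 * F t x z p X} =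
      f p X '' Metric.closedBall 0 s⁻¹ := by
    ext b
    simp [hf, quadForm, sum_mul_eq_inner, eq_comm]
  simp only [hset]
  set V := φ x - s ^ 20 * F t x z q H
  have hne (p X) : (f p X '' Metric.closedBall 0 s⁻¹).Nonempty :=
    ⟨_, 0, by simp [hs.le], rfl⟩
  have hupper (p : Euc d) (X : Matrix (Fin d) (Fin d) ℝ) (hX : X.IsSymm) (hXM : frobNorm X ≤ M) :
      sInf (f p X '' Metric.closedBall 0 s⁻¹) ≤ V + (d ^ 3 + 1) * C₂ * s ^ 22 := by
    have hcont : Continuous (f p X) := by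
      have := hφ.continuous
      have := continuous_quadForm X
      fun_prop
    have hbdd : BddBelow (f p X '' Metric.closedBall 0 s⁻¹) :=
      (isCompact_closedBall _ _).bddBelow_image hcont.continuousOn
    obtain ⟨μ, hμ, v, hv, hquad, hpsd⟩ := exists_shift_posSemidef (hHs.sub hX)
    obtain ⟨w, u, h₁, h₂, hgain⟩ := exists_penalizing_directions hC₀ hs hs2 hsC hM (q - p)
      hHM hXM hμ hv hquad
    have hFle := mul_le_mul_of_nonneg_left
      (nonlinearity_sub_le hC₀.le hF ht x z p q hX hHs hμ hpsd) (by positivity : 0 ≤ s ^ 20)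
    have i₁ := csInf_le hbdd (mem_image_of_mem (f p X) (by simpa using h₁ : w + u ∈ _))
    have i₂ := csInf_le hbdd (mem_image_of_mem (f p X) (by simpa using h₂ : w - u ∈ _))
    have k₁ := (abs_le.1 (htaylor _ h₁)).2
    have k₂ := (abs_le.1 (htaylor _ h₂)).2
    have pH := quadForm_parallelogram H w u
    have pX := quadForm_parallelogram X w u
    simp only [hf, inner_add_right, inner_sub_right] at i₁ i₂ k₁ k₂
    simp only [quadForm_sub, inner_sub_left] at hgain
    have hsum : s ^ 20 / 2 * (quadForm H (w + u) - quadForm X (w + u)) +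
        s ^ 20 / 2 * (quadForm H (w - u) - quadForm X (w - u)) =
        2 * (s ^ 20 / 2 * (quadForm H w - quadForm X w + (quadForm H u - quadForm X u))) := by
      linear_combination s ^ 20 / 2 * (pH - pX)
    linarith
  have hbound : ∀ a ∈ {a : ℝ | ∃ (p : Euc d) (X : Matrix (Fin d) (Fin d) ℝ),
      X.IsSymm ∧ ‖p‖ ≤ M ∧ frobNorm X ≤ M ∧ a = sInf (f p X '' Metric.closedBall 0 s⁻¹)},
      a ≤ V + (d ^ 3 + 1) * C₂ * s ^ 22 := by
    rintro a ⟨p, X, hX, -, hXM, rfl⟩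
    exact hupper p X hX hXM
  have hlower : V - d ^ 3 * C₂ * s ^ 22 ≤ sInf (f q H '' Metric.closedBall 0 s⁻¹) := by
    refine le_csInf (hne q H) ?_
    rintro b ⟨w, hw, rfl⟩
    have := (abs_le.1 (htaylor w (by simpa using hw))).1
    simp only [hf]
    linarith
  have hmem : sInf (f q H '' Metric.closedBall 0 s⁻¹) ∈
      {a : ℝ | ∃ (p : Euc d) (X : Matrix (Fin d) (Fin d) ℝ), X.IsSymm ∧ ‖p‖ ≤ M ∧
        frobNorm X ≤ M ∧ a = sInf (f p X '' Metric.closedBall 0 s⁻¹)} :=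
    ⟨q, H, hHs, hqM, hHM, rfl⟩
  have hsup := le_csSup ⟨_, hbound⟩ hmem
  have hsup' := csSup_le ⟨_, hmem⟩ hbound
  have hpos : 0 ≤ C₂ * s ^ 22 := by positivity
  rw [abs_le]
  constructor <;> linarith

end

/-- Lemma 4.6: max–min representation of the nonlinearity, up to an
error of order `δ^{1+ϵ}`, uniformly over test functions with `Σ_{|α|₁≤3} sup |D^αφ|
≤ C₂ δ^{−θ}`. -/
theorem maxmin_representation
    (d : ℕ) (T : ℝ) (hT : 0 < T) (θ : ℝ) (hθ : θ ∈ Ioo (0:ℝ) (1/5))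
    (C₂ : ℝ) (hC₂ : 0 < C₂)
    (F : ℝ → Euc d → ℝ → Euc d → Matrix (Fin d) (Fin d) ℝ → ℝ)
    (C₀ : ℝ) (hC₀ : 0 < C₀) (hF : Assumption41F T C₀ F)
    (O : Set (Euc d)) (hO : IsOpen O) (hOb : Bornology.IsBounded O) :
    ∃ δ₁ : ℝ, 0 < δ₁ ∧ ∃ ϵ : ℝ, 0 < ϵ ∧ ∃ κ ∈ Ioo (0:ℝ) (1/6), ∃ C : ℝ, 0 < C ∧
      ∀ t ∈ Icc (0:ℝ) T, ∀ x ∈ O, ∀ z : ℝ, ∀ δ ∈ Ioc (0:ℝ) δ₁,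
      ∀ φ : Euc d → ℝ, ContDiff ℝ 3 φ →
      (∃ B : (Fin d → ℕ) → ℝ,
        (∀ α ∈ multiIdx3 d, ∀ y : Euc d, |Dmulti α φ y| ≤ B α) ∧
        (∑ α ∈ multiIdx3 d, B α) ≤ C₂ * δ ^ (-θ)) →
      |φ x - δ * F t x z (gradient φ x) (hessian φ x) -
        sSup {a : ℝ | ∃ (p : Euc d) (X : Matrix (Fin d) (Fin d) ℝ),
          X.IsSymm ∧ ‖p‖ ≤ C₂ * δ ^ (-θ) ∧ frobNorm X ≤ C₂ * δ ^ (-θ) ∧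
          a = sInf {b : ℝ | ∃ w : Euc d, ‖w‖ ≤ δ ^ (-κ) ∧
            b = φ (x + Real.sqrt δ • w) - Real.sqrt δ * (∑ i, w i * p i) -
              (δ / 2) * (∑ i, ∑ j, w i * X i j * w j) - δ * F t x z p X}}|
        ≤ C * δ ^ (1 + ϵ) := by
  have hd : (0 : ℝ) ≤ d := Nat.cast_nonneg d
  set s₁ : ℝ := (8 * C₀ * (d + 1) + 2)⁻¹ with hs₁
  have hs₁0 : 0 < s₁ := by positivity
  refine ⟨s₁ ^ 20, by positivity, 1 / 10, by norm_num, 1 / 20, by norm_num,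
    (d ^ 3 + 1) * C₂, by positivity, ?_⟩
  rintro t ht x - z δ ⟨hδ, hδ₁⟩ φ hφ ⟨B, hB, hBM⟩
  obtain ⟨s, hs, rfl⟩ : ∃ s : ℝ, 0 < s ∧ s ^ 20 = δ :=
    ⟨δ ^ (1 / 20 : ℝ), by positivity, by
      rw [← Real.rpow_natCast, ← Real.rpow_mul hδ.le]; norm_num⟩
  have hle : s ≤ s₁ := le_of_pow_le_pow_left₀ (by norm_num) hs₁0.le hδ₁
  have hmul : s * (8 * C₀ * (d + 1) + 2) ≤ 1 := by
    rwa [hs₁, ← one_div, le_div_iff₀ (by positivity)] at hle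
  have hpos : 0 < s * (8 * C₀ * (d + 1)) := by positivity
  have hpow (a : ℝ) : (s ^ 20) ^ a = s ^ (20 * a) := by
    rw [← Real.rpow_natCast, ← Real.rpow_mul hs.le]; norm_num
  have hsqrt : √(s ^ 20) = s ^ 10 := by
    rw [show s ^ 20 = (s ^ 10) ^ 2 by ring, Real.sqrt_sq (by positivity)]
  have hκ : (s ^ 20) ^ (-(1 / 20) : ℝ) = s⁻¹ := by
    rw [hpow, ← Real.rpow_neg_one]; norm_num
  have hϵ : (s ^ 20) ^ (1 + 1 / 10 : ℝ) = s ^ 22 := by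
    rw [hpow, ← Real.rpow_natCast]; norm_num
  have hM : C₂ * (s ^ 20) ^ (-θ) * s ^ 4 ≤ C₂ := by
    rw [hpow, mul_assoc, ← Real.rpow_natCast s 4, ← Real.rpow_add hs]
    refine mul_le_of_le_one_right hC₂.le (Real.rpow_le_one hs.le (by linarith) ?_)
    push_cast
    linarith [hθ.2]
  rw [hsqrt, hκ, hϵ]
  exact maxmin_representation_scaled hF hC₀ hs (by linarith) (by linarith) hM ht x z hφ hB hBM
end
end

section
/- Let S be a nonempty set, N ∈ ℕ, q : S → ℝ^N, and u, w ∈ ℝ^N, and let ‖·‖ denote the Euclidean norm on ℝ^N. Let ε > 0 and suppose θ_u, θ_w ∈ S are ε-optimal, i.e., ‖u − q(θ_u)‖² ≤ inf_{θ∈S} ‖u − q(θ)‖² + ε² and ‖w − q(θ_w)‖² ≤ inf_{θ∈S} ‖w − q(θ)‖² + ε². Then ‖q(θ_u) − q(θ_w)‖ ≤ 2‖u − w‖ + 2‖w − q(θ_w)‖ + ε. -/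
/-- abstract ℓ²-stability of ε-optimal least-squares solutions. -/
theorem eps_optimal_stability
    {S : Type*} [Nonempty S] (N : ℕ) (q : S → EuclideanSpace ℝ (Fin N))
    (u w : EuclideanSpace ℝ (Fin N)) (ε : ℝ) (hε : 0 < ε) (θu θw : S)
    (hu : ‖u - q θu‖ ^ 2 ≤ sInf {s : ℝ | ∃ θ : S, s = ‖u - q θ‖ ^ 2} + ε ^ 2)
    (hw : ‖w - q θw‖ ^ 2 ≤ sInf {s : ℝ | ∃ θ : S, s = ‖w - q θ‖ ^ 2} + ε ^ 2) :
    ‖q θu - q θw‖ ≤ 2 * ‖u - w‖ + 2 * ‖w - q θw‖ + ε := by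
  have hinf : sInf {s : ℝ | ∃ θ : S, s = ‖u - q θ‖ ^ 2} ≤ ‖u - q θw‖ ^ 2 :=
    csInf_le ⟨0, by rintro _ ⟨θ, rfl⟩; positivity⟩ ⟨θw, rfl⟩
  have hres : ‖u - q θu‖ ≤ ‖u - q θw‖ + ε := by
    refine abs_le_of_sq_le_sq' ?_ (by positivity) |>.2
    nlinarith [mul_nonneg (norm_nonneg (u - q θw)) hε.le]
  have hsplit : ‖q θu - q θw‖ ≤ ‖u - q θu‖ + ‖u - q θw‖ := by
    simpa only [norm_sub_rev (q θu) u] using norm_sub_le_norm_sub_add_norm_sub (q θu) u (q θw)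
  linarith [norm_sub_le_norm_sub_add_norm_sub u w (q θw)]
end
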